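/- Let a be a continuous positive function on the closed unit square, let z₀, z₁ > 0, and let I₀, I₁ ∈ ℝ satisfy I₀ + I₁ = 0. Let v be continuously differentiable on an open neighborhood of the closed unit square with ε ≤ a/|∇v| ≤ 1/ε on the closed square for some ε > 0, and suppose σ := a/|∇v| is continuously differentiable there. Let (u, U) be a classical CEM solution for the conductivity σ with impedances z₀, z₁ and currents I₀, I₁. Then for every V = (V₀,V₁) ∈ ℝ² with V₀ + V₁ = 0 one has G_a(u,U) ≤ G_a(v,V); moreover, if equality holds for some such V, then u = v on the closed square and U = V. -/

import Mathlib

open MeasureTheory Set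

/-- Partial derivative in the first (x) variable. -/
noncomputable def pdx (u : ℝ × ℝ → ℝ) (p : ℝ × ℝ) : ℝ :=
  deriv (fun t => u (t, p.2)) p.1

/-- Partial derivative in the second (y) variable. -/
noncomputable def pdy (u : ℝ × ℝ → ℝ) (p : ℝ × ℝ) : ℝ :=
  deriv (fun t => u (p.1, t)) p.2

/-- Euclidean norm of the gradient `|∇u|`. -/
noncomputable def gradNorm (u : ℝ × ℝ → ℝ) (p : ℝ × ℝ) : ℝ :=
  Real.sqrt ((pdx u p) ^ 2 + (pdy u p) ^ 2)

/-- The closed unit square `[0,1] × [0,1]`. -/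
def SQ : Set (ℝ × ℝ) := Icc (0 : ℝ) 1 ×ˢ Icc (0 : ℝ) 1

/-- The open unit square `(0,1) × (0,1)`. -/
def SQo : Set (ℝ × ℝ) := Ioo (0 : ℝ) 1 ×ˢ Ioo (0 : ℝ) 1

/-- `v` is continuously differentiable on an open neighborhood of the closed unit square. -/
def C1Nbhd (v : ℝ × ℝ → ℝ) : Prop :=
  ∃ W : Set (ℝ × ℝ), IsOpen W ∧ SQ ⊆ W ∧ ContDiffOn ℝ 1 v W

/-- A classical solution `(u, (U₀, U₁))` of the Complete Electrode Model on the unit square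
for the conductivity `σ`, constant impedances `z₀, z₁` (bottom/top electrodes) and
input currents `I₀, I₁`. -/
structure IsCEMSolution (σ u : ℝ × ℝ → ℝ) (U₀ U₁ z₀ z₁ I₀ I₁ : ℝ) : Prop where
  smooth : ∃ W : Set (ℝ × ℝ), IsOpen W ∧ SQ ⊆ W ∧ ContDiffOn ℝ 2 u W
  ground : U₀ + U₁ = 0
  pde : ∀ p ∈ SQo,
    pdx (fun q => σ q * pdx u q) p + pdy (fun q => σ q * pdy u q) p = 0
  robin_bot : ∀ x ∈ Icc (0 : ℝ) 1, u (x, 0) - z₀ * σ (x, 0) * pdy u (x, 0) = U₀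
  robin_top : ∀ x ∈ Icc (0 : ℝ) 1, u (x, 1) + z₁ * σ (x, 1) * pdy u (x, 1) = U₁
  flux_bot : (∫ x in (0 : ℝ)..1, -(σ (x, 0) * pdy u (x, 0))) = I₀
  flux_top : (∫ x in (0 : ℝ)..1, σ (x, 1) * pdy u (x, 1)) = I₁
  noflux_left : ∀ y ∈ Icc (0 : ℝ) 1, pdx u (0, y) = 0
  noflux_right : ∀ y ∈ Icc (0 : ℝ) 1, pdx u (1, y) = 0

/-- The weighted least-gradient functional `G_a` with CEM boundary terms. -/
noncomputable def Gfun (a : ℝ × ℝ → ℝ) (z₀ z₁ I₀ I₁ : ℝ) (v : ℝ × ℝ → ℝ)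
    (V₀ V₁ : ℝ) : ℝ :=
  (∫ p in SQo, a p * gradNorm v p)
    + (1 / (2 * z₀)) * (∫ x in (0 : ℝ)..1, (v (x, 0) - V₀) ^ 2)
    + (1 / (2 * z₁)) * (∫ x in (0 : ℝ)..1, (v (x, 1) - V₁) ^ 2)
    - I₀ * V₀ - I₁ * V₁

/-- The CEM energy functional `F_σ`. -/
noncomputable def Ffun (σ : ℝ × ℝ → ℝ) (z₀ z₁ I₀ I₁ : ℝ) (v : ℝ × ℝ → ℝ)
    (V₀ V₁ : ℝ) : ℝ :=
  (1 / 2) * (∫ p in SQo, σ p * ((pdx v p) ^ 2 + (pdy v p) ^ 2))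
    + (1 / (2 * z₀)) * (∫ x in (0 : ℝ)..1, (v (x, 0) - V₀) ^ 2)
    + (1 / (2 * z₁)) * (∫ x in (0 : ℝ)..1, (v (x, 1) - V₁) ^ 2)
    - I₀ * V₀ - I₁ * V₁

theorem pdx_eq_fderiv {f : ℝ × ℝ → ℝ} {p : ℝ × ℝ} (h : DifferentiableAt ℝ f p) :
    pdx f p = fderiv ℝ f p (1, 0) := by
  have h₁ : HasDerivAt (fun t : ℝ => (t, p.2)) ((1 : ℝ), (0 : ℝ)) p.1 :=
    (hasDerivAt_id p.1).prodMk (hasDerivAt_const p.1 p.2)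
  exact (h.hasFDerivAt.comp_hasDerivAt p.1 h₁).deriv

theorem pdy_eq_fderiv {f : ℝ × ℝ → ℝ} {p : ℝ × ℝ} (h : DifferentiableAt ℝ f p) :
    pdy f p = fderiv ℝ f p (0, 1) := by
  have h₁ : HasDerivAt (fun t : ℝ => (p.1, t)) ((0 : ℝ), (1 : ℝ)) p.2 :=
    (hasDerivAt_const p.2 p.1).prodMk (hasDerivAt_id p.2)
  exact (h.hasFDerivAt.comp_hasDerivAt p.2 h₁).deriv

theorem ContDiffOn.differentiableAt_of_isOpen {f : ℝ × ℝ → ℝ} {W : Set (ℝ × ℝ)}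
    (hf : ContDiffOn ℝ 1 f W) (hW : IsOpen W) {p : ℝ × ℝ} (hp : p ∈ W) :
    DifferentiableAt ℝ f p :=
  (hf.differentiableOn one_ne_zero).differentiableAt (hW.mem_nhds hp)

theorem contDiffOn_pdx {f : ℝ × ℝ → ℝ} {W : Set (ℝ × ℝ)} (hW : IsOpen W) {m n : ℕ}
    (hmn : m + 1 ≤ n) (hf : ContDiffOn ℝ n f W) : ContDiffOn ℝ m (pdx f) W := by
  have hf' : ContDiffOn ℝ m (fderiv ℝ f) W :=
    hf.fderiv_of_isOpen hW (by exact_mod_cast hmn)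
  refine (hf'.clm_apply (contDiffOn_const (c := ((1 : ℝ), (0 : ℝ))))).congr fun p hp => ?_
  exact pdx_eq_fderiv (ContDiffOn.differentiableAt_of_isOpen
    (hf.of_le (by exact_mod_cast (by omega : 1 ≤ n))) hW hp)

theorem contDiffOn_pdy {f : ℝ × ℝ → ℝ} {W : Set (ℝ × ℝ)} (hW : IsOpen W) {m n : ℕ}
    (hmn : m + 1 ≤ n) (hf : ContDiffOn ℝ n f W) : ContDiffOn ℝ m (pdy f) W := by
  have hf' : ContDiffOn ℝ m (fderiv ℝ f) W :=
    hf.fderiv_of_isOpen hW (by exact_mod_cast hmn)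
  refine (hf'.clm_apply (contDiffOn_const (c := ((0 : ℝ), (1 : ℝ))))).congr fun p hp => ?_
  exact pdy_eq_fderiv (ContDiffOn.differentiableAt_of_isOpen
    (hf.of_le (by exact_mod_cast (by omega : 1 ≤ n))) hW hp)

theorem pdx_mul {f g : ℝ × ℝ → ℝ} {p : ℝ × ℝ} (hf : DifferentiableAt ℝ f p)
    (hg : DifferentiableAt ℝ g p) :
    pdx (fun q => f q * g q) p = pdx f p * g p + f p * pdx g p := by
  rw [pdx_eq_fderiv (hf.fun_mul hg), pdx_eq_fderiv hf, pdx_eq_fderiv hg, fderiv_fun_mul hf hg]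
  simp; ring

theorem pdy_mul {f g : ℝ × ℝ → ℝ} {p : ℝ × ℝ} (hf : DifferentiableAt ℝ f p)
    (hg : DifferentiableAt ℝ g p) :
    pdy (fun q => f q * g q) p = pdy f p * g p + f p * pdy g p := by
  rw [pdy_eq_fderiv (hf.fun_mul hg), pdy_eq_fderiv hf, pdy_eq_fderiv hg, fderiv_fun_mul hf hg]
  simp; ring

theorem pdx_sub {f g : ℝ × ℝ → ℝ} {p : ℝ × ℝ} (hf : DifferentiableAt ℝ f p)
    (hg : DifferentiableAt ℝ g p) :
    pdx (fun q => f q - g q) p = pdx f p - pdx g p := by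
  rw [pdx_eq_fderiv (hf.fun_sub hg), pdx_eq_fderiv hf, pdx_eq_fderiv hg, fderiv_fun_sub hf hg]
  simp

theorem pdy_sub {f g : ℝ × ℝ → ℝ} {p : ℝ × ℝ} (hf : DifferentiableAt ℝ f p)
    (hg : DifferentiableAt ℝ g p) :
    pdy (fun q => f q - g q) p = pdy f p - pdy g p := by
  rw [pdy_eq_fderiv (hf.fun_sub hg), pdy_eq_fderiv hf, pdy_eq_fderiv hg, fderiv_fun_sub hf hg]
  simp

theorem SQ_eq_Icc : SQ = Icc ((0 : ℝ), (0 : ℝ)) (1, 1) := Icc_prod_Icc ..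

theorem SQo_subset_SQ : SQo ⊆ SQ := prod_mono Ioo_subset_Icc_self Ioo_subset_Icc_self

theorem isOpen_SQo : IsOpen SQo := isOpen_Ioo.prod isOpen_Ioo

theorem closure_SQo : closure SQo = SQ := by
  rw [SQo, closure_prod_eq, closure_Ioo zero_ne_one, SQ]

theorem isPreconnected_SQo : IsPreconnected SQo :=
  ((convex_Ioo (0 : ℝ) 1).prod (convex_Ioo (0 : ℝ) 1)).isPreconnected

theorem SQo_ae_eq_SQ : SQo =ᵐ[volume] SQ :=
  Measure.set_prod_ae_eq Ioo_ae_eq_Icc Ioo_ae_eq_Icc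

theorem ContinuousOn.integrableOn_SQo {f : ℝ × ℝ → ℝ} (hf : ContinuousOn f SQ) :
    IntegrableOn f SQo := by
  rw [SQ_eq_Icc] at hf
  exact (hf.integrableOn_compact isCompact_Icc).mono_set (SQ_eq_Icc ▸ SQo_subset_SQ)

theorem ContinuousOn.comp_horizontal {f : ℝ × ℝ → ℝ} (hf : ContinuousOn f SQ) {y : ℝ}
    (hy : y ∈ Icc (0 : ℝ) 1) : ContinuousOn (fun x => f (x, y)) (Icc 0 1) :=
  hf.comp (by fun_prop) fun _ hx => ⟨hx, hy⟩

theorem ContinuousOn.intervalIntegrable_unit {f : ℝ → ℝ} (hf : ContinuousOn f (Icc 0 1)) :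
    IntervalIntegrable f volume 0 1 :=
  hf.intervalIntegrable_of_Icc zero_le_one

/-- The divergence theorem on the unit square. -/
theorem integral_SQo_divergence {F G : ℝ × ℝ → ℝ} {W : Set (ℝ × ℝ)} (hW : IsOpen W)
    (hSW : SQ ⊆ W) (hF : ContDiffOn ℝ 1 F W) (hG : ContDiffOn ℝ 1 G W) :
    ∫ p in SQo, (pdx F p + pdy G p) =
      (∫ x in (0 : ℝ)..1, G (x, 1)) - (∫ x in (0 : ℝ)..1, G (x, 0)) +
        (∫ y in (0 : ℝ)..1, F (1, y)) - ∫ y in (0 : ℝ)..1, F (0, y) := by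
  have hdF : ∀ p ∈ SQ, DifferentiableAt ℝ F p := fun p hp =>
    hF.differentiableAt_of_isOpen hW (hSW hp)
  have hdG : ∀ p ∈ SQ, DifferentiableAt ℝ G p := fun p hp =>
    hG.differentiableAt_of_isOpen hW (hSW hp)
  have hcont : ContinuousOn (fun p => fderiv ℝ F p (1, 0) + fderiv ℝ G p (0, 1)) SQ :=
    (((hF.continuousOn_fderiv_of_isOpen hW le_rfl).mono hSW).clm_apply continuousOn_const).add
      (((hG.continuousOn_fderiv_of_isOpen hW le_rfl).mono hSW).clm_apply continuousOn_const)
  rw [setIntegral_congr_set SQo_ae_eq_SQ, setIntegral_congr_fun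
    (g := fun p => fderiv ℝ F p (1, 0) + fderiv ℝ G p (0, 1))
    (s := SQ) (measurableSet_Icc.prod measurableSet_Icc)
    fun p hp => by simp only [pdx_eq_fderiv (hdF p hp), pdy_eq_fderiv (hdG p hp)], SQ_eq_Icc]
  rw [SQ_eq_Icc] at hcont
  refine integral_divergence_prod_Icc_of_hasFDerivAt_of_le F G (fderiv ℝ F) (fderiv ℝ G)
    (0, 0) (1, 1) (by simp) ?_ ?_ ?_ ?_ (hcont.integrableOn_compact isCompact_Icc)
  · exact SQ_eq_Icc ▸ hF.continuousOn.mono hSW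
  · exact SQ_eq_Icc ▸ hG.continuousOn.mono hSW
  · exact fun p hp => (hdF p (SQo_subset_SQ hp)).hasFDerivAt
  · exact fun p hp => (hdG p (SQo_subset_SQ hp)).hasFDerivAt

/-- Weak form of the conductivity equation with insulated left and right edges. -/
theorem integral_SQo_sigma_grad_inner {σ u w : ℝ × ℝ → ℝ} {W : Set (ℝ × ℝ)} (hW : IsOpen W)
    (hSW : SQ ⊆ W) (hσ : ContDiffOn ℝ 1 σ W) (hu : ContDiffOn ℝ 2 u W)
    (hw : ContDiffOn ℝ 1 w W)
    (hpde : ∀ p ∈ SQo,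
      pdx (fun q => σ q * pdx u q) p + pdy (fun q => σ q * pdy u q) p = 0)
    (hl : ∀ y ∈ Icc (0 : ℝ) 1, pdx u (0, y) = 0)
    (hr : ∀ y ∈ Icc (0 : ℝ) 1, pdx u (1, y) = 0) :
    ∫ p in SQo, σ p * (pdx u p * pdx w p + pdy u p * pdy w p) =
      (∫ x in (0 : ℝ)..1, σ (x, 1) * pdy u (x, 1) * w (x, 1)) -
        ∫ x in (0 : ℝ)..1, σ (x, 0) * pdy u (x, 0) * w (x, 0) := by
  have hux : ContDiffOn ℝ 1 (fun q => σ q * pdx u q) W :=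
    hσ.mul (by exact_mod_cast contDiffOn_pdx hW (m := 1) (n := 2) le_rfl (by exact_mod_cast hu))
  have huy : ContDiffOn ℝ 1 (fun q => σ q * pdy u q) W :=
    hσ.mul (by exact_mod_cast contDiffOn_pdy hW (m := 1) (n := 2) le_rfl (by exact_mod_cast hu))
  have hdiv := integral_SQo_divergence hW hSW (hux.mul hw) (huy.mul hw)
  have hside : ∀ c : ℝ, (∀ y ∈ Icc (0 : ℝ) 1, pdx u (c, y) = 0) →
      ∫ y in (0 : ℝ)..1, σ (c, y) * pdx u (c, y) * w (c, y) = 0 := fun c hc => by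
    rw [intervalIntegral.integral_congr (g := fun _ => 0), intervalIntegral.integral_zero]
    intro y hy
    rw [uIcc_of_le zero_le_one] at hy
    simp [hc y hy]
  rw [hside 0 hl, hside 1 hr, add_zero, sub_zero] at hdiv
  rw [← hdiv]
  refine setIntegral_congr_fun isOpen_SQo.measurableSet fun p hp => ?_
  have hpW := hSW (SQo_subset_SQ hp)
  have hdw := hw.differentiableAt_of_isOpen hW hpW
  rw [pdx_mul (hux.differentiableAt_of_isOpen hW hpW) hdw,
    pdy_mul (huy.differentiableAt_of_isOpen hW hpW) hdw]
  linear_combination (-w p) * hpde p hp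

/-- Expansion of an electrode term around a function satisfying the Robin and flux conditions,
where `q` is the outward current density. -/
theorem electrode_term_sub {f g q : ℝ → ℝ} {z I c d : ℝ} (hz : 0 < z)
    (hf : ContinuousOn f (Icc 0 1)) (hg : ContinuousOn g (Icc 0 1))
    (hq : ContinuousOn q (Icc 0 1)) (hrobin : ∀ x ∈ Icc (0 : ℝ) 1, f x + z * q x = c)
    (hflux : ∫ x in (0 : ℝ)..1, q x = I) :
    (1 / (2 * z) * (∫ x in (0 : ℝ)..1, (g x - d) ^ 2) - I * d) -
      (1 / (2 * z) * (∫ x in (0 : ℝ)..1, (f x - c) ^ 2) - I * c) =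
    1 / (2 * z) * (∫ x in (0 : ℝ)..1, (g x - f x - (d - c)) ^ 2) -
      ∫ x in (0 : ℝ)..1, q x * (g x - f x) := by
  have i₁ : IntervalIntegrable (fun x => (f x - c) ^ 2) volume 0 1 :=
    ContinuousOn.intervalIntegrable_unit (by fun_prop)
  have i₂ : IntervalIntegrable (fun x => (g x - f x - (d - c)) ^ 2) volume 0 1 :=
    ContinuousOn.intervalIntegrable_unit (by fun_prop)
  have i₃ : IntervalIntegrable (fun x => q x * (g x - f x)) volume 0 1 :=
    ContinuousOn.intervalIntegrable_unit (by fun_prop)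
  have i₄ : IntervalIntegrable q volume 0 1 := hq.intervalIntegrable_unit
  have key : ∫ x in (0 : ℝ)..1, (g x - d) ^ 2 =
      ∫ x in (0 : ℝ)..1, ((f x - c) ^ 2 + (g x - f x - (d - c)) ^ 2
        - (2 * z) * (q x * (g x - f x)) + (2 * z * (d - c)) * q x) := by
    refine intervalIntegral.integral_congr fun x hx => ?_
    rw [uIcc_of_le zero_le_one] at hx
    linear_combination (2 * (g x - f x - (d - c))) * hrobin x hx
  rw [intervalIntegral.integral_add ((i₁.add i₂).sub (i₃.const_mul _)) (i₄.const_mul _),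
    intervalIntegral.integral_sub (i₁.add i₂) (i₃.const_mul _),
    intervalIntegral.integral_add i₁ i₂, intervalIntegral.integral_const_mul,
    intervalIntegral.integral_const_mul, hflux] at key
  rw [key]
  field_simp
  ring

theorem exists_const_of_integral_grad_sq_eq_zero {σ w : ℝ × ℝ → ℝ} {W : Set (ℝ × ℝ)}
    (hW : IsOpen W) (hSW : SQ ⊆ W) (hw : ContDiffOn ℝ 1 w W) (hσ : ContinuousOn σ SQ)
    (hσpos : ∀ p ∈ SQ, 0 < σ p)
    (h : ∫ p in SQo, σ p * ((pdx w p) ^ 2 + (pdy w p) ^ 2) = 0) :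
    ∃ c, ∀ p ∈ SQ, w p = c := by
  have hwx : ContinuousOn (pdx w) SQ :=
    ((contDiffOn_pdx hW (m := 0) (n := 1) le_rfl (by exact_mod_cast hw)).continuousOn).mono hSW
  have hwy : ContinuousOn (pdy w) SQ :=
    ((contDiffOn_pdy hW (m := 0) (n := 1) le_rfl (by exact_mod_cast hw)).continuousOn).mono hSW
  have hcont : ContinuousOn (fun p => σ p * ((pdx w p) ^ 2 + (pdy w p) ^ 2)) SQ := by fun_prop
  have hnn : 0 ≤ᵐ[volume.restrict SQo] fun p => σ p * ((pdx w p) ^ 2 + (pdy w p) ^ 2) :=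
    ae_restrict_of_forall_mem isOpen_SQo.measurableSet fun p hp =>
      mul_nonneg (hσpos p (SQo_subset_SQ hp)).le (by positivity)
  have hzero := Measure.eqOn_open_of_ae_eq
    ((setIntegral_eq_zero_iff_of_nonneg_ae hnn hcont.integrableOn_SQo).1 h) isOpen_SQo
    (hcont.mono SQo_subset_SQ) continuousOn_const
  have hd : ∀ p ∈ SQo, DifferentiableAt ℝ w p := fun p hp =>
    hw.differentiableAt_of_isOpen hW (hSW (SQo_subset_SQ hp))
  obtain ⟨c, hc⟩ := isOpen_SQo.exists_is_const_of_fderiv_eq_zero (𝕜 := ℝ) (f := w)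
    isPreconnected_SQo (fun p hp => (hd p hp).differentiableWithinAt) fun p hp => by
      have h₀ : σ p * ((pdx w p) ^ 2 + (pdy w p) ^ 2) = 0 := hzero hp
      have h₁ := (mul_eq_zero.1 h₀).resolve_left (hσpos p (SQo_subset_SQ hp)).ne'
      have hx : pdx w p = 0 := by nlinarith [sq_nonneg (pdx w p), sq_nonneg (pdy w p)]
      have hy : pdy w p = 0 := by nlinarith [sq_nonneg (pdx w p), sq_nonneg (pdy w p)]
      rw [pdx_eq_fderiv (hd p hp)] at hx
      rw [pdy_eq_fderiv (hd p hp)] at hy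
      ext <;> simp [hx, hy]
  exact ⟨c, EqOn.of_subset_closure (f := w) (g := fun _ => c) hc (hw.continuousOn.mono hSW)
    continuousOn_const SQo_subset_SQ closure_SQo.superset⟩

/-- Monotone decrease of `G_a` along the reconstruction algorithm: if `u` is the CEM solution
for the updated conductivity `σ = a/|∇v|`, then `G_a(u,U) ≤ G_a(v,V)`, with equality only
when `(u,U) = (v,V)`. -/
theorem Ga_decreases_along_iteration (a : ℝ × ℝ → ℝ)
    (ha : ContinuousOn a SQ) (hapos : ∀ p ∈ SQ, 0 < a p)
    (z₀ z₁ I₀ I₁ : ℝ) (hz₀ : 0 < z₀) (hz₁ : 0 < z₁) (hI : I₀ + I₁ = 0)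
    (v : ℝ × ℝ → ℝ) (hv : C1Nbhd v) (ε : ℝ) (hε : 0 < ε)
    (hbound : ∀ p ∈ SQ, ε ≤ a p / gradNorm v p ∧ a p / gradNorm v p ≤ 1 / ε)
    (hσsmooth : ∃ W : Set (ℝ × ℝ), IsOpen W ∧ SQ ⊆ W ∧
      ContDiffOn ℝ 1 (fun p => a p / gradNorm v p) W)
    (u : ℝ × ℝ → ℝ) (U₀ U₁ : ℝ)
    (hsol : IsCEMSolution (fun p => a p / gradNorm v p) u U₀ U₁ z₀ z₁ I₀ I₁) :
    ∀ V₀ V₁ : ℝ, V₀ + V₁ = 0 →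
      Gfun a z₀ z₁ I₀ I₁ u U₀ U₁ ≤ Gfun a z₀ z₁ I₀ I₁ v V₀ V₁ ∧
      (Gfun a z₀ z₁ I₀ I₁ u U₀ U₁ = Gfun a z₀ z₁ I₀ I₁ v V₀ V₁ →
        (∀ p ∈ SQ, u p = v p) ∧ U₀ = V₀ ∧ U₁ = V₁) := by
  intro V₀ V₁ hV
  obtain ⟨Wv, hWv, hSv, hvW⟩ := hv
  obtain ⟨Ws, hWs, hSs, hsW⟩ := hσsmooth
  obtain ⟨Wu, hWu, hSu, huW⟩ := hsol.smooth
  have hagrad : ∀ p ∈ SQ, a p = a p / gradNorm v p * gradNorm v p := fun p hp => by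
    have hne : gradNorm v p ≠ 0 := fun h0 => by
      have := (hbound p hp).1
      rw [h0, div_zero] at this
      exact absurd this (not_le.2 hε)
    field_simp
  have hσpos : ∀ p ∈ SQ, 0 < a p / gradNorm v p := fun p hp => hε.trans_le (hbound p hp).1
  generalize hσdef : (fun p => a p / gradNorm v p) = σ at *
  have hσp : ∀ p, a p / gradNorm v p = σ p := fun p => congrFun hσdef p
  simp only [hσp] at hagrad hσpos
  obtain ⟨-, hU, hpde, hrb, hrt, hfb, hft, hnl, hnr⟩ := hsol
  set W := Wv ∩ (Ws ∩ Wu)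
  have hW : IsOpen W := hWv.inter (hWs.inter hWu)
  have hSW : SQ ⊆ W := subset_inter hSv (subset_inter hSs hSu)
  have hvC : ContDiffOn ℝ 1 v W := hvW.mono inter_subset_left
  have hσC : ContDiffOn ℝ 1 σ W := hsW.mono fun p hp => hp.2.1
  have huC : ContDiffOn ℝ 2 u W := huW.mono fun p hp => hp.2.2
  have huC1 : ContDiffOn ℝ 1 u W := huC.of_le (by norm_num)
  have hwC : ContDiffOn ℝ 1 (fun p => v p - u p) W := hvC.sub huC1
  have hcx : ∀ f : ℝ × ℝ → ℝ, ContDiffOn ℝ 1 f W → ContinuousOn (pdx f) SQ := fun f hf =>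
    ((contDiffOn_pdx hW (m := 0) (n := 1) le_rfl (by exact_mod_cast hf)).continuousOn).mono hSW
  have hcy : ∀ f : ℝ × ℝ → ℝ, ContDiffOn ℝ 1 f W → ContinuousOn (pdy f) SQ := fun f hf =>
    ((contDiffOn_pdy hW (m := 0) (n := 1) le_rfl (by exact_mod_cast hf)).continuousOn).mono hSW
  have hux := hcx u huC1
  have huy := hcy u huC1
  have hwx := hcx _ hwC
  have hwy := hcy _ hwC
  have hσc : ContinuousOn σ SQ := hσC.continuousOn.mono hSW
  have huc : ContinuousOn u SQ := huC.continuousOn.mono hSW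
  have hvc : ContinuousOn v SQ := hvC.continuousOn.mono hSW
  have hq : ContinuousOn (fun p => σ p * pdy u p) SQ := hσc.mul huy
  have h0 : (0 : ℝ) ∈ Icc (0 : ℝ) 1 := by simp
  have h1 : (1 : ℝ) ∈ Icc (0 : ℝ) 1 := by simp
  have hgreen := integral_SQo_sigma_grad_inner hW hSW hσC huC hwC hpde hnl hnr
  have hbot := electrode_term_sub (f := fun x => u (x, 0)) (g := fun x => v (x, 0))
    (q := fun x => -(σ (x, 0) * pdy u (x, 0))) (c := U₀) (d := V₀) hz₀
    (huc.comp_horizontal h0) (hvc.comp_horizontal h0) (hq.comp_horizontal h0).neg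
    (fun x hx => by rw [← hrb x hx]; ring) hfb
  have htop := electrode_term_sub (f := fun x => u (x, 1)) (g := fun x => v (x, 1))
    (q := fun x => σ (x, 1) * pdy u (x, 1)) (c := U₁) (d := V₁) hz₁
    (huc.comp_horizontal h1) (hvc.comp_horizontal h1) (hq.comp_horizontal h1)
    (fun x hx => by rw [← hrt x hx]; ring) hft
  simp only [neg_mul, intervalIntegral.integral_neg] at hbot
  have hgc : ∀ f : ℝ × ℝ → ℝ, ContDiffOn ℝ 1 f W → ContinuousOn (gradNorm f) SQ :=
    fun f hf => (((hcx f hf).pow 2).add ((hcy f hf).pow 2)).sqrt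
  have iv : IntegrableOn (fun p => a p * gradNorm v p) SQo :=
    (ha.mul (hgc v hvC)).integrableOn_SQo
  have iu : IntegrableOn (fun p => a p * gradNorm u p) SQo :=
    (ha.mul (hgc u huC1)).integrableOn_SQo
  have iw : IntegrableOn (fun p => σ p * ((pdx (fun p => v p - u p) p) ^ 2
      + (pdy (fun p => v p - u p) p) ^ 2)) SQo :=
    (hσc.mul ((hwx.pow 2).add (hwy.pow 2))).integrableOn_SQo
  have im : IntegrableOn (fun p => σ p * (pdx u p * pdx (fun p => v p - u p) p
      + pdy u p * pdy (fun p => v p - u p) p)) SQo :=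
    (hσc.mul ((hux.mul hwx).add (huy.mul hwy))).integrableOn_SQo
  have hint := setIntegral_mono_on ((iu.add (iw.const_mul (1 / 2))).add im) iv
    isOpen_SQo.measurableSet fun p hp => by
      have hpS := SQo_subset_SQ hp
      have hdv := hvC.differentiableAt_of_isOpen hW (hSW hpS)
      have hdu := huC1.differentiableAt_of_isOpen hW (hSW hpS)
      have hv2 : gradNorm v p ^ 2 = pdx v p ^ 2 + pdy v p ^ 2 := Real.sq_sqrt (by positivity)
      have hu2 : gradNorm u p ^ 2 = pdx u p ^ 2 + pdy u p ^ 2 := Real.sq_sqrt (by positivity)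
      simp only [Pi.add_apply]
      rw [pdx_sub hdv hdu, pdy_sub hdv hdu, hagrad p hpS]
      have := mul_nonneg (hσpos p hpS).le (sq_nonneg (gradNorm v p - gradNorm u p))
      linear_combination (1 / 2) * this + (σ p / 2) * hu2 - (σ p / 2) * hv2
  have hadd := integral_add (iu.add (iw.const_mul (1 / 2))) im
  have hadd' := integral_add iu (iw.const_mul (1 / 2))
  simp only [Pi.add_apply, integral_const_mul] at hint hadd hadd'
  rw [hadd, hadd', hgreen] at hint
  have hE : 0 ≤ ∫ p in SQo, σ p * ((pdx (fun p => v p - u p) p) ^ 2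
      + (pdy (fun p => v p - u p) p) ^ 2) :=
    setIntegral_nonneg isOpen_SQo.measurableSet fun p hp =>
      mul_nonneg (hσpos p (SQo_subset_SQ hp)).le (by positivity)
  have hB₀ : 0 ≤ 1 / (2 * z₀) * ∫ x in (0 : ℝ)..1, (v (x, 0) - u (x, 0) - (V₀ - U₀)) ^ 2 :=
    mul_nonneg (by positivity)
      (intervalIntegral.integral_nonneg zero_le_one fun x _ => sq_nonneg _)
  have hB₁ : 0 ≤ 1 / (2 * z₁) * ∫ x in (0 : ℝ)..1, (v (x, 1) - u (x, 1) - (V₁ - U₁)) ^ 2 :=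
    mul_nonneg (by positivity)
      (intervalIntegral.integral_nonneg zero_le_one fun x _ => sq_nonneg _)
  unfold Gfun
  refine ⟨by linarith, fun heq => ?_⟩
  obtain ⟨c, hc⟩ := exists_const_of_integral_grad_sq_eq_zero hW hSW hwC hσc hσpos
    (le_antisymm (by linarith) hE)
  have hedge : ∀ y ∈ Icc (0 : ℝ) 1, ∀ z d : ℝ, 0 < z →
      1 / (2 * z) * (∫ x in (0 : ℝ)..1, (v (x, y) - u (x, y) - d) ^ 2) = 0 → c = d := by
    intro y hy z d hz h
    rw [intervalIntegral.integral_congr (g := fun _ => (c - d) ^ 2) fun x hx => by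
      rw [uIcc_of_le zero_le_one] at hx
      simp only [hc (x, y) ⟨hx, hy⟩]] at h
    have h' : (c - d) ^ 2 = 0 := by
      simpa [hz.ne'] using h
    exact sub_eq_zero.1 (pow_eq_zero_iff two_ne_zero |>.1 h')
  have hc₀ := hedge 0 h0 z₀ (V₀ - U₀) hz₀ (le_antisymm (by linarith) hB₀)
  have hc₁ := hedge 1 h1 z₁ (V₁ - U₁) hz₁ (le_antisymm (by linarith) hB₁)
  refine ⟨fun p hp => ?_, by linarith, by linarith⟩
  linarith [hc p hp]
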